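/- arXiv:2302.03407 — 3 statements merged into one kernel-verified Lean document; each statement's English description precedes it below -/
import Mathlib

section
/- Assume F, f : ℝⁿ × ℝᵐ → ℝ are twice continuously differentiable and that for every x the map y ↦ f(x,y) is strongly convex, with unique minimizer y*(x), and set Φ(x) := F(x, y*(x)). Then ∇Φ(x) = 0 if and only if there exist y ∈ ℝᵐ and v ∈ ℝᵐ such that the KKT residual KKT(x,y,v) = 0, i.e. ∇_x F(x,y) − ∇²_{xy} f(x,y) v = 0, ∇_y F(x,y) − ∇²_{yy} f(x,y) v = 0 and ∇_y f(x,y) = 0. Moreover, in that case necessarily y = y*(x) and v = [∇²_{yy} f(x, y*(x))]⁻¹ ∇_y F(x, y*(x)). -/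
open Set Filter Asymptotics
open scoped NNReal

noncomputable section

/-- `ℝⁿ` as a Euclidean space. -/
abbrev Eu (n : ℕ) : Type := EuclideanSpace ℝ (Fin n)

variable {n m : ℕ}

/-- Partial gradient with respect to the first (upper-level) variable. -/
def gradx (F : Eu n → Eu m → ℝ) (x : Eu n) (y : Eu m) : Eu n :=
  gradient (fun x' => F x' y) x

/-- Partial gradient with respect to the second (lower-level) variable. -/
def grady (F : Eu n → Eu m → ℝ) (x : Eu n) (y : Eu m) : Eu m :=
  gradient (fun y' => F x y') y

/-- Second-order partial derivative `∇²_{yy}`. -/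
def hessyy (F : Eu n → Eu m → ℝ) (x : Eu n) (y : Eu m) : Eu m →L[ℝ] Eu m :=
  fderiv ℝ (fun y' => grady F x y') y

/-- Mixed second-order partial derivative `∇²_{xy}`, viewed as the linear map
sending a multiplier `v ∈ ℝᵐ` to an element of `ℝⁿ`. -/
def hessxy (F : Eu n → Eu m → ℝ) (x : Eu n) (y : Eu m) : Eu m →L[ℝ] Eu n :=
  ContinuousLinearMap.adjoint (fderiv ℝ (fun x' => grady F x' y) x)

/-- The aggregation function `ψ_μ = μ F + (1-μ) f`. -/
def aggreg (μ : ℝ) (F f : Eu n → Eu m → ℝ) : Eu n → Eu m → ℝ :=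
  fun x y => μ * F x y + (1 - μ) * f x y

/-- The squared KKT residual of the equality-constrained reformulation
`min F(x,y) s.t. ∇_y f(x,y) = 0`. -/
def KKTres (F f : Eu n → Eu m → ℝ) (x : Eu n) (y v : Eu m) : ℝ :=
  ‖gradx F x y - hessxy f x y v‖ ^ 2 + ‖grady F x y - hessyy f x y v‖ ^ 2 +
    ‖grady f x y‖ ^ 2

open scoped RealInnerProductSpace Gradient

section StrongConvexity

variable {E : Type*} [NormedAddCommGroup E] [InnerProductSpace ℝ E] [CompleteSpace E]
  {g : E → ℝ} {σ : ℝ}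

theorem StrongConvexOn.monotone_inner_gradient_lineMap (hg : StrongConvexOn univ σ g)
    (hd : Differentiable ℝ g) (y d : E) :
    Monotone fun t : ℝ => ⟪∇ g (y + t • d), d⟫ - σ * ⟪y + t • d, d⟫ := by
  have hderiv : ∀ t : ℝ, HasDerivAt (fun t : ℝ => g (y + t • d) - σ / 2 * ‖y + t • d‖ ^ 2)
      (⟪∇ g (y + t • d), d⟫ - σ * ⟪y + t • d, d⟫) t := by
    intro t
    have hline : HasDerivAt (fun t : ℝ => y + t • d) d t := by
      simpa using ((hasDerivAt_id t).smul_const d).const_add y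
    have h₁ := (hd (y + t • d)).hasFDerivAt.comp_hasDerivAt t hline
    have h₂ := (hline.norm_sq).const_mul (σ / 2)
    rw [← inner_gradient_left] at h₁
    refine (h₁.sub h₂).congr_deriv ?_
    rw [← mul_assoc, div_mul_cancel₀ σ two_ne_zero]
  have hconv : ConvexOn ℝ univ (fun t : ℝ => g (y + t • d) - σ / 2 * ‖y + t • d‖ ^ 2) := by
    have h := (strongConvexOn_iff_convex.1 hg).comp_affineMap (AffineMap.lineMap y (y + d))
    simpa [Function.comp_def, AffineMap.lineMap_apply, add_comm] using h
  have hmono := hconv.monotoneOn_deriv fun t _ => (hderiv t).differentiableAt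
  simpa [funext fun t => (hderiv t).deriv] using! (monotoneOn_univ.1 hmono)

theorem StrongConvexOn.mul_norm_sq_le_inner_gradient_sub (hg : StrongConvexOn univ σ g)
    (hd : Differentiable ℝ g) (y z : E) :
    σ * ‖z - y‖ ^ 2 ≤ ⟪∇ g z - ∇ g y, z - y⟫ := by
  have h := hg.monotone_inner_gradient_lineMap hd y (z - y) zero_le_one
  simp only [zero_smul, add_zero, one_smul, add_sub_cancel] at h
  rw [inner_sub_left, ← real_inner_self_eq_norm_sq, inner_sub_left]
  linarith

theorem StrongConvexOn.gradient_injective (hg : StrongConvexOn univ σ g) (hσ : 0 < σ)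
    (hd : Differentiable ℝ g) : Function.Injective (∇ g) := by
  intro y z h
  have hle := hg.mul_norm_sq_le_inner_gradient_sub hd y z
  rw [h, sub_self, inner_zero_left] at hle
  have hnorm : ‖z - y‖ ^ 2 = 0 := le_antisymm (by nlinarith) (sq_nonneg _)
  exact (sub_eq_zero.1 (norm_eq_zero.1 (pow_eq_zero_iff two_ne_zero |>.1 hnorm))).symm

theorem StrongConvexOn.mul_norm_sq_le_inner_fderiv_gradient (hg : StrongConvexOn univ σ g)
    (hd : Differentiable ℝ g) {y : E} (hd' : DifferentiableAt ℝ (∇ g) y) (d : E) :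
    σ * ‖d‖ ^ 2 ≤ ⟪fderiv ℝ (∇ g) y d, d⟫ := by
  have hline : HasDerivAt (fun t : ℝ => y + t • d) d 0 := by
    simpa using ((hasDerivAt_id (0 : ℝ)).smul_const d).const_add y
  have hgrad : HasDerivAt (fun t : ℝ => ∇ g (y + t • d)) (fderiv ℝ (∇ g) y d) 0 := by
    refine HasFDerivAt.comp_hasDerivAt (l := ∇ g) 0 ?_ hline
    simpa using hd'.hasFDerivAt
  have h := (hgrad.inner ℝ (hasDerivAt_const 0 d)).sub
    ((hline.inner ℝ (hasDerivAt_const 0 d)).const_mul σ)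
  have hnonneg := (Monotone.deriv_nonneg (x := 0)
    (hg.monotone_inner_gradient_lineMap hd y d)).trans_eq h.deriv
  simp only [inner_zero_right, zero_add, real_inner_self_eq_norm_sq] at hnonneg
  linarith

theorem StrongConvexOn.isInvertible_fderiv_gradient [FiniteDimensional ℝ E]
    (hg : StrongConvexOn univ σ g) (hσ : 0 < σ) (hd : Differentiable ℝ g) {y : E}
    (hd' : DifferentiableAt ℝ (∇ g) y) : (fderiv ℝ (∇ g) y).IsInvertible := by
  have hinj : Function.Injective (fderiv ℝ (∇ g) y : E →ₗ[ℝ] E) := by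
    refine (injective_iff_map_eq_zero _).2 fun d h => ?_
    have hle := hg.mul_norm_sq_le_inner_fderiv_gradient hd hd' d
    rw [show fderiv ℝ (∇ g) y d = 0 from h, inner_zero_left] at hle
    have hnorm : ‖d‖ ^ 2 = 0 := le_antisymm (by nlinarith) (sq_nonneg _)
    exact norm_eq_zero.1 (pow_eq_zero_iff two_ne_zero |>.1 hnorm)
  exact ⟨(LinearEquiv.ofInjectiveEndo _ hinj).toContinuousLinearEquiv, by ext; rfl⟩

theorem inner_fderiv_gradient_comm {y : E} (hg : ContDiffAt ℝ 2 g y) (d e : E) :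
    ⟪fderiv ℝ (∇ g) y d, e⟫ = ⟪d, fderiv ℝ (∇ g) y e⟫ := by
  have hd : DifferentiableAt ℝ (fderiv ℝ g) y :=
    (hg.fderiv_right (m := 1) (by norm_num)).differentiableAt (by norm_num)
  have hfd : ∀ a b, ⟪fderiv ℝ (∇ g) y a, b⟫ = fderiv ℝ (fderiv ℝ g) y a b := by
    intro a b
    have h : HasFDerivAt (∇ g) _ y :=
      ((InnerProductSpace.toDual ℝ E).symm.toContinuousLinearEquiv.toContinuousLinearMap.hasFDerivAt
        (x := fderiv ℝ g y)).comp y hd.hasFDerivAt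
    rw [h.fderiv]
    exact InnerProductSpace.toDual_symm_apply
  rw [hfd, real_inner_comm, hfd]
  exact hg.isSymmSndFDerivAt (by simp) d e

end StrongConvexity

section PartialGradients

variable {F : Eu n → Eu m → ℝ}

theorem inner_gradx (hF : Differentiable ℝ (Function.uncurry F)) (x u : Eu n) (y : Eu m) :
    ⟪gradx F x y, u⟫ = fderiv ℝ (Function.uncurry F) (x, y) (u, 0) := by
  have h := (hF (x, y)).hasFDerivAt.comp (f := fun x' => (x', y)) x
    (hasFDerivAt_prodMk_left x y)
  rw [gradx, inner_gradient_left,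
    show fderiv ℝ (fun x' => F x' y) x = _ from h.fderiv]
  simp

theorem inner_grady (hF : Differentiable ℝ (Function.uncurry F)) (x : Eu n) (y u : Eu m) :
    ⟪grady F x y, u⟫ = fderiv ℝ (Function.uncurry F) (x, y) (0, u) := by
  have h := (hF (x, y)).hasFDerivAt.comp y (hasFDerivAt_prodMk_right x y)
  rw [grady, inner_gradient_left,
    show fderiv ℝ (fun y' => F x y') y = _ from h.fderiv]
  simp

theorem contDiff_uncurry_grady (hF : ContDiff ℝ 2 (Function.uncurry F)) :
    ContDiff ℝ 1 (Function.uncurry (grady F)) := by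
  have hd : Differentiable ℝ (Function.uncurry F) := hF.differentiable (by norm_num)
  have hfd : ContDiff ℝ 1 (fderiv ℝ (Function.uncurry F)) := hF.fderiv_right (by norm_num)
  have heq : Function.uncurry (grady F) = fun p => (InnerProductSpace.toDual ℝ (Eu m)).symm
      (fderiv ℝ (Function.uncurry F) p ∘L .inr ℝ (Eu n) (Eu m)) := by
    funext p
    refine ext_inner_right ℝ fun u => ?_
    rw [InnerProductSpace.toDual_symm_apply]
    exact inner_grady hd p.1 p.2 u
  rw [heq]
  exact (InnerProductSpace.toDual ℝ (Eu m)).symm.contDiff.comp (hfd.clm_comp contDiff_const)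

theorem hessyy_eq_fderiv_comp_inr (hF : ContDiff ℝ 2 (Function.uncurry F)) (x : Eu n)
    (y : Eu m) :
    fderiv ℝ (Function.uncurry (grady F)) (x, y) ∘L .inr ℝ (Eu n) (Eu m) = hessyy F x y :=
  ((((contDiff_uncurry_grady hF).differentiable (by norm_num) (x, y)).hasFDerivAt.comp y
    (hasFDerivAt_prodMk_right x y)).fderiv).symm

theorem inner_hessxy (hF : ContDiff ℝ 2 (Function.uncurry F)) (x u : Eu n) (y v : Eu m) :
    ⟪hessxy F x y v, u⟫ = ⟪v, fderiv ℝ (Function.uncurry (grady F)) (x, y) (u, 0)⟫ := by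
  have h := ((contDiff_uncurry_grady hF).differentiable (by norm_num) (x, y)).hasFDerivAt.comp
    (f := fun x' => (x', y)) x (hasFDerivAt_prodMk_left x y)
  rw [hessxy, ContinuousLinearMap.adjoint_inner_left,
    show fderiv ℝ (fun x' => grady F x' y) x = _ from h.fderiv]
  simp

end PartialGradients

section Hypergradient

variable {F f : Eu n → Eu m → ℝ} {σ : ℝ} {ystar : Eu n → Eu m}

theorem isInvertible_hessyy (hf : ContDiff ℝ 2 (Function.uncurry f)) (hσ : 0 < σ) {x : Eu n}
    (hsc : StrongConvexOn univ σ (f x)) (y : Eu m) : (hessyy f x y).IsInvertible := by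
  have hfx : ContDiff ℝ 2 (f x) := hf.comp (contDiff_prodMk_right x)
  have hgx : ContDiff ℝ 1 (grady f x) :=
    (contDiff_uncurry_grady hf).comp (contDiff_prodMk_right x)
  exact hsc.isInvertible_fderiv_gradient hσ (hfx.differentiable (by norm_num))
    (hgx.differentiable (by norm_num) y)

theorem grady_eq_zero_of_forall_le {x : Eu n} {y : Eu m} (hmin : ∀ z, f x y ≤ f x z) :
    grady f x y = 0 := by
  have h : fderiv ℝ (f x) y = 0 := IsLocalMin.fderiv_eq_zero (Eventually.of_forall hmin)
  change gradient (f x) y = 0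
  rw [gradient, h, map_zero]

theorem grady_eq_zero_iff (hf : ContDiff ℝ 2 (Function.uncurry f)) (hσ : 0 < σ) {x : Eu n}
    (hsc : StrongConvexOn univ σ (f x)) {y₀ y : Eu m} (hmin : ∀ z, f x y₀ ≤ f x z) :
    grady f x y = 0 ↔ y = y₀ := by
  have hfx : ContDiff ℝ 2 (f x) := hf.comp (contDiff_prodMk_right x)
  have h₀ := grady_eq_zero_of_forall_le hmin
  refine ⟨fun h => ?_, fun h => h ▸ h₀⟩
  exact hsc.gradient_injective hσ (hfx.differentiable (by norm_num)) (h.trans h₀.symm)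

theorem hasFDerivAt_lower_minimizer (hf : ContDiff ℝ 2 (Function.uncurry f)) (hσ : 0 < σ)
    (hsc : ∀ x, StrongConvexOn univ σ (f x)) (hmin : ∀ x y, f x (ystar x) ≤ f x y) (x : Eu n) :
    HasFDerivAt ystar (-(hessyy f x (ystar x)).inverse ∘L
      (fderiv ℝ (Function.uncurry (grady f)) (x, ystar x) ∘L .inl ℝ (Eu n) (Eu m))) x := by
  have hstrict := (contDiff_uncurry_grady hf).contDiffAt.hasStrictFDerivAt
    (x := (x, ystar x)) (by norm_num)
  have hinv : (fderiv ℝ (Function.uncurry (grady f)) (x, ystar x) ∘L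
      .inr ℝ (Eu n) (Eu m)).IsInvertible := by
    rw [hessyy_eq_fderiv_comp_inr hf]
    exact isInvertible_hessyy hf hσ (hsc x) _
  have h := (hstrict.hasStrictFDerivAt_implicitFunctionOfProdDomain hinv).hasFDerivAt
  rw [hessyy_eq_fderiv_comp_inr hf] at h
  refine h.congr_of_eventuallyEq ?_
  filter_upwards [hstrict.eventually_apply_implicitFunctionOfProdDomain hinv] with x' hx'
  refine ((grady_eq_zero_iff hf hσ (hsc x') (hmin x')).1 ?_).symm
  exact hx'.trans (grady_eq_zero_of_forall_le (hmin x))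

theorem gradient_value_eq (hF : ContDiff ℝ 2 (Function.uncurry F))
    (hf : ContDiff ℝ 2 (Function.uncurry f)) (hσ : 0 < σ)
    (hsc : ∀ x, StrongConvexOn univ σ (f x)) (hmin : ∀ x y, f x (ystar x) ≤ f x y) (x : Eu n) :
    gradient (fun x' => F x' (ystar x')) x = gradx F x (ystar x) -
      hessxy f x (ystar x) ((hessyy f x (ystar x)).inverse (grady F x (ystar x))) := by
  have hFd : Differentiable ℝ (Function.uncurry F) := hF.differentiable (by norm_num)
  have hinv := isInvertible_hessyy hf hσ (hsc x) (ystar x)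
  have hfx : ContDiff ℝ 2 (f x) := hf.comp (contDiff_prodMk_right x)
  have hchain := (hFd (x, ystar x)).hasFDerivAt.comp x
    ((hasFDerivAt_id x).prodMk (hasFDerivAt_lower_minimizer hf hσ hsc hmin x))
  have hsymm : ∀ a b, ⟪(hessyy f x (ystar x)).inverse a, b⟫ =
      ⟪a, (hessyy f x (ystar x)).inverse b⟫ := by
    intro a b
    have h := inner_fderiv_gradient_comm (y := ystar x) hfx.contDiffAt
      ((hessyy f x (ystar x)).inverse a) ((hessyy f x (ystar x)).inverse b)
    change ⟪hessyy f x (ystar x) _, _⟫ = ⟪_, hessyy f x (ystar x) _⟫ at h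
    rw [hinv.self_apply_inverse, hinv.self_apply_inverse] at h
    exact h.symm
  refine ext_inner_right ℝ fun u => ?_
  rw [inner_sub_left, inner_gradx hFd, inner_hessxy hf, hsymm,
    inner_gradient_left,
    show fderiv ℝ (fun x' => F x' (ystar x')) x = _ from hchain.fderiv, inner_grady hFd,
    ← map_sub]
  simp

end Hypergradient

/-- Proposition 2.1: under lower-level strong convexity, `∇Φ(x) = 0`
iff the KKT residual vanishes for some `(y, v)`; moreover in that case `y = y*(x)` and
`v = [∇²_{yy} f(x,y*(x))]⁻¹ ∇_y F(x,y*(x))`. -/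
theorem kkt_iff_hypergradient_zero {n m : ℕ}
    (F f : Eu n → Eu m → ℝ)
    (hF : ContDiff ℝ 2 (Function.uncurry F))
    (hf : ContDiff ℝ 2 (Function.uncurry f))
    (σf : ℝ) (hσf : 0 < σf)
    (hsc : ∀ x, StrongConvexOn univ σf (f x))
    (ystar : Eu n → Eu m)
    (hmin : ∀ x y, f x (ystar x) ≤ f x y)
    (x : Eu n) :
    (gradient (fun x' => F x' (ystar x')) x = 0 ↔
      ∃ (y : Eu m) (v : Eu m),
        gradx F x y - hessxy f x y v = 0 ∧
        grady F x y - hessyy f x y v = 0 ∧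
        grady f x y = 0) ∧
    ∀ (y : Eu m) (v : Eu m),
      gradx F x y - hessxy f x y v = 0 →
      grady F x y - hessyy f x y v = 0 →
      grady f x y = 0 →
      y = ystar x ∧
      v = (hessyy f x (ystar x)).inverse (grady F x (ystar x)) := by
  have hzero : ∀ y, grady f x y = 0 ↔ y = ystar x := fun y =>
    grady_eq_zero_iff hf hσf (hsc x) (hmin x)
  have hinv := isInvertible_hessyy hf hσf (hsc x) (ystar x)
  have huniq : ∀ y v, grady F x y - hessyy f x y v = 0 → grady f x y = 0 →
      y = ystar x ∧ v = (hessyy f x (ystar x)).inverse (grady F x (ystar x)) := by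
    intro y v hv hy
    obtain rfl := (hzero y).1 hy
    refine ⟨rfl, ?_⟩
    rw [sub_eq_zero.1 hv, hinv.inverse_apply_self]
  rw [gradient_value_eq hF hf hσf hsc hmin x]
  refine ⟨⟨fun h => ⟨ystar x, _, h, ?_, (hzero _).2 rfl⟩, ?_⟩, fun y v _ => huniq y v⟩
  · rw [hinv.self_apply_inverse, sub_self]
  · rintro ⟨y, v, hx, hv, hy⟩
    obtain ⟨rfl, rfl⟩ := huniq y v hv hy
    exact hx
end
end

section
/- Under the smoothness and convexity assumptions, for every μ with σ_{ψμ} > 0 and all x, x' ∈ ℝⁿ, ‖v*_μ(x) − v*_μ(x')‖ ≤ ((L_{v1} ‖v*_μ(x)‖ + L_{v2}) / σ_{ψμ}²) ‖x − x'‖, where L_{v1} := L_{ψyy2} L_{ψy1} + L_{ψyy1} σ_{ψμ} and L_{v2} := L_{Fy2} L_{ψy1} + L_{Fy1} σ_{ψμ}. -/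
open Set Filter Asymptotics
open scoped NNReal

noncomputable section

variable {n m : ℕ}

open scoped RealInnerProductSpace

section InnerProductSpace

variable {E : Type*} [NormedAddCommGroup E] [InnerProductSpace ℝ E]

/-- The gradient of a strongly convex function is strongly monotone. -/
theorem StrongConvexOn.le_inner_gradient_sub [CompleteSpace E] {g : E → ℝ} {σ : ℝ}
    (hg : StrongConvexOn univ σ g) (hd : Differentiable ℝ g) (x y : E) :
    σ * ‖y - x‖ ^ 2 ≤ ⟪gradient g y - gradient g x, y - x⟫ := by
  have hc := strongConvexOn_iff_convex.1 hg
  have hline : ConvexOn ℝ univ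
      (fun t : ℝ => g (AffineMap.lineMap x y t) - σ / 2 * ‖AffineMap.lineMap x y t‖ ^ 2) := by
    simpa [Function.comp_def] using hc.comp_affineMap (AffineMap.lineMap (k := ℝ) x y)
  have hderiv : ∀ t : ℝ, HasDerivAt
      (fun t : ℝ => g (AffineMap.lineMap x y t) - σ / 2 * ‖AffineMap.lineMap x y t‖ ^ 2)
      (⟪gradient g (AffineMap.lineMap x y t), y - x⟫
        - σ / 2 * (2 * ⟪AffineMap.lineMap x y t, y - x⟫)) t := by
    intro t
    have hl : HasDerivAt (fun t : ℝ => AffineMap.lineMap x y t) (y - x) t :=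
      AffineMap.hasDerivAt_lineMap
    have h1 := (hd (AffineMap.lineMap x y t)).hasGradientAt.hasFDerivAt.comp_hasDerivAt t hl
    simp only [InnerProductSpace.toDual_apply_apply] at h1
    exact h1.sub (hl.norm_sq.const_mul _)
  have h0 := hline.le_slope_of_hasDerivAt (mem_univ 0) (mem_univ 1) zero_lt_one (hderiv 0)
  have h1 := hline.slope_le_of_hasDerivAt (mem_univ 0) (mem_univ 1) zero_lt_one (hderiv 1)
  have h := h0.trans h1
  simp only [AffineMap.lineMap_apply_zero, AffineMap.lineMap_apply_one] at h
  rw [inner_sub_left, ← real_inner_self_eq_norm_sq, inner_sub_left y x (y - x)]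
  linarith

/-- The derivative of a strongly monotone map is coercive. -/
theorem HasFDerivAt.le_inner_of_stronglyMonotone {G : E → E} {G' : E →L[ℝ] E} {σ : ℝ} {y : E}
    (hG : HasFDerivAt G G' y) (hmono : ∀ a b, σ * ‖b - a‖ ^ 2 ≤ ⟪G b - G a, b - a⟫) (v : E) :
    σ * ‖v‖ ^ 2 ≤ ⟪G' v, v⟫ := by
  have hl : HasDerivAt (fun t : ℝ => y + t • v) v 0 := by
    simpa using ((hasDerivAt_id (0 : ℝ)).smul_const v).const_add y
  have hGl : HasDerivAt (fun t : ℝ => G (y + t • v)) (G' v) 0 :=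
    HasFDerivAt.comp_hasDerivAt (0 : ℝ) (by simpa using hG) hl
  have hφ : HasDerivAt (fun t : ℝ => ⟪G (y + t • v), v⟫ - t * (σ * ‖v‖ ^ 2))
      (⟪G' v, v⟫ - σ * ‖v‖ ^ 2) 0 := by
    have h := (hGl.inner ℝ (hasDerivAt_const (0 : ℝ) v)).sub
      ((hasDerivAt_id (0 : ℝ)).mul_const (σ * ‖v‖ ^ 2))
    rw [inner_zero_right, zero_add, one_mul] at h
    exact h
  have hm : Monotone (fun t : ℝ => ⟪G (y + t • v), v⟫ - t * (σ * ‖v‖ ^ 2)) := by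
    refine monotone_iff_forall_lt.2 fun s t hst => ?_
    have h := hmono (y + s • v) (y + t • v)
    rw [add_sub_add_left_eq_sub, ← sub_smul, norm_smul, mul_pow, inner_smul_right,
      Real.norm_eq_abs, sq_abs, inner_sub_left] at h
    have hpos : 0 < t - s := sub_pos.2 hst
    have h' : (t - s) * ((t - s) * (σ * ‖v‖ ^ 2)) ≤
        (t - s) * (⟪G (y + t • v), v⟫ - ⟪G (y + s • v), v⟫) := by linarith
    have := le_of_mul_le_mul_left h' hpos
    linarith
  have := hm.deriv_nonneg (x := 0)
  rw [hφ.deriv] at this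
  linarith

/-- Cauchy–Schwarz turns coercivity of a pairing into a lower norm bound. -/
theorem mul_norm_le_of_mul_norm_sq_le_inner {σ : ℝ} {u v : E} (h : σ * ‖v‖ ^ 2 ≤ ⟪u, v⟫) :
    σ * ‖v‖ ≤ ‖u‖ := by
  rcases (norm_nonneg v).eq_or_lt with hv | hv
  · simp [← hv]
  · have := h.trans (real_inner_le_norm u v)
    exact le_of_mul_le_mul_right (by linarith) hv

theorem ContinuousLinearMap.isInvertible_of_mul_norm_le [FiniteDimensional ℝ E] {A : E →L[ℝ] E}
    {σ : ℝ} (hσ : 0 < σ) (hA : ∀ v, σ * ‖v‖ ≤ ‖A v‖) : A.IsInvertible := by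
  have hinj : Function.Injective (A : E →ₗ[ℝ] E) := by
    refine (injective_iff_map_eq_zero _).2 fun v hv => norm_le_zero_iff.1 ?_
    have h := hA v
    rw [show A v = 0 from hv, norm_zero] at h
    exact nonpos_of_mul_nonpos_right h hσ
  exact ⟨(LinearEquiv.ofInjectiveEndo (A : E →ₗ[ℝ] E) hinj).toContinuousLinearEquiv, by ext; rfl⟩

/-- Perturbation bound for the solution of a linear system. -/
theorem ContinuousLinearMap.mul_norm_sub_le_of_mul_norm_le {A B : E →L[ℝ] E} {σ : ℝ}
    (hB : ∀ v, σ * ‖v‖ ≤ ‖B v‖) (v w : E) :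
    σ * ‖v - w‖ ≤ ‖A - B‖ * ‖v‖ + ‖A v - B w‖ := by
  refine (hB (v - w)).trans ?_
  have h : B (v - w) = (A v - B w) - (A - B) v := by simp
  rw [h, add_comm]
  exact (norm_sub_le _ _).trans (by gcongr; exact (A - B).le_opNorm v)

end InnerProductSpace

section PartialDerivatives

variable {F f : Eu n → Eu m → ℝ}

theorem differentiable_right_of_contDiff_uncurry (hF : ContDiff ℝ 2 (Function.uncurry F))
    (x : Eu n) : Differentiable ℝ (F x) :=
  (hF.comp (contDiff_prodMk_right x)).differentiable (by norm_num)

theorem differentiable_grady (hF : ContDiff ℝ 2 (Function.uncurry F)) (x : Eu n) :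
    Differentiable ℝ (grady F x) := by
  have h : ContDiff ℝ 2 (F x) := hF.comp (contDiff_prodMk_right x)
  have h' : ContDiff ℝ 1 (fderiv ℝ (F x)) := h.fderiv_right (by norm_num)
  exact (InnerProductSpace.toDual ℝ (Eu m)).symm.toContinuousLinearEquiv.differentiable.comp
    (h'.differentiable (by norm_num))

theorem grady_aggreg (μ : ℝ) {x : Eu n} (hF : Differentiable ℝ (F x))
    (hf : Differentiable ℝ (f x)) (y : Eu m) :
    grady (aggreg μ F f) x y = μ • grady F x y + (1 - μ) • grady f x y := by
  have h := ((hF y).hasFDerivAt.const_mul μ).add ((hf y).hasFDerivAt.const_mul (1 - μ))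
  have h' : fderiv ℝ (fun y' => aggreg μ F f x y') y =
      μ • fderiv ℝ (F x) y + (1 - μ) • fderiv ℝ (f x) y := h.fderiv
  simp only [grady, gradient, h', map_add, map_smul]

theorem hasFDerivAt_grady_aggreg (μ : ℝ) (hF : ContDiff ℝ 2 (Function.uncurry F))
    (hf : ContDiff ℝ 2 (Function.uncurry f)) (x : Eu n) (y : Eu m) :
    HasFDerivAt (grady (aggreg μ F f) x) (μ • hessyy F x y + (1 - μ) • hessyy f x y) y := by
  have h : grady (aggreg μ F f) x = fun y' => μ • grady F x y' + (1 - μ) • grady f x y' :=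
    funext (grady_aggreg μ (differentiable_right_of_contDiff_uncurry hF x)
      (differentiable_right_of_contDiff_uncurry hf x))
  rw [h]
  exact ((differentiable_grady hF x y).hasFDerivAt.const_smul μ).add
    ((differentiable_grady hf x y).hasFDerivAt.const_smul (1 - μ))

theorem hessyy_aggreg (μ : ℝ) (hF : ContDiff ℝ 2 (Function.uncurry F))
    (hf : ContDiff ℝ 2 (Function.uncurry f)) (x : Eu n) (y : Eu m) :
    hessyy (aggreg μ F f) x y = μ • hessyy F x y + (1 - μ) • hessyy f x y :=
  (hasFDerivAt_grady_aggreg μ hF hf x y).fderiv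

theorem le_inner_grady_aggreg_sub {μ σF σf : ℝ} (hμ : μ ∈ Icc (0 : ℝ) 1) {x : Eu n}
    (hF : Differentiable ℝ (F x)) (hf : Differentiable ℝ (f x))
    (hFsc : StrongConvexOn univ σF (F x)) (hfsc : StrongConvexOn univ σf (f x)) (a b : Eu m) :
    (μ * σF + (1 - μ) * σf) * ‖b - a‖ ^ 2 ≤
      ⟪grady (aggreg μ F f) x b - grady (aggreg μ F f) x a, b - a⟫ := by
  have h1 := mul_le_mul_of_nonneg_left (hFsc.le_inner_gradient_sub hF a b) hμ.1
  have h2 := mul_le_mul_of_nonneg_left (hfsc.le_inner_gradient_sub hf a b) (sub_nonneg.2 hμ.2)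
  rw [grady_aggreg μ hF hf, grady_aggreg μ hF hf, add_sub_add_comm, ← smul_sub, ← smul_sub,
    inner_add_left, real_inner_smul_left, real_inner_smul_left]
  simp only [grady]
  linarith

end PartialDerivatives

/-- Convex combinations of two differences inherit the combined bound. -/
theorem norm_convexComb_sub_le {V : Type*} [SeminormedAddCommGroup V] [NormedSpace ℝ V]
    {μ K L d : ℝ} (hμ : μ ∈ Icc (0 : ℝ) 1) {a a' b b' : V}
    (ha : ‖a - a'‖ ≤ K * d) (hb : ‖b - b'‖ ≤ L * d) :
    ‖(μ • a + (1 - μ) • b) - (μ • a' + (1 - μ) • b')‖ ≤ (μ * K + (1 - μ) * L) * d := by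
  have h1 := mul_le_mul_of_nonneg_left ha hμ.1
  have h2 := mul_le_mul_of_nonneg_left hb (sub_nonneg.2 hμ.2)
  rw [add_sub_add_comm, ← smul_sub, ← smul_sub]
  refine (norm_add_le _ _).trans ?_
  rw [norm_smul, norm_smul, Real.norm_of_nonneg hμ.1, Real.norm_of_nonneg (sub_nonneg.2 hμ.2)]
  linarith

/-- A map that is Lipschitz in each variable satisfies the joint estimate. -/
theorem norm_sub_le_of_lipschitzWith {X Y V : Type*} [SeminormedAddCommGroup X]
    [SeminormedAddCommGroup Y] [SeminormedAddCommGroup V] {G : X → Y → V} {K L : ℝ≥0}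
    (hK : ∀ y, LipschitzWith K fun x => G x y) (hL : ∀ x, LipschitzWith L fun y => G x y)
    (x x' : X) (y y' : Y) : ‖G x y - G x' y'‖ ≤ K * ‖x - x'‖ + L * ‖y - y'‖ := by
  refine (norm_sub_le_norm_sub_add_norm_sub _ (G x' y) _).trans ?_
  exact add_le_add ((hK y).norm_sub_le x x') ((hL x').norm_sub_le y y')

/-- Lemma A.1 (ii), second part: Lipschitz-type continuity of
`x ↦ v*_μ(x)`. -/
theorem vstar_lipschitz {n m : ℕ}
    (F f : Eu n → Eu m → ℝ)
    (hF : ContDiff ℝ 2 (Function.uncurry F))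
    (hf : ContDiff ℝ 2 (Function.uncurry f))
    (LFy1 LFy2 Lfy1 Lfy2 LFyy1 LFyy2 Lfyy1 Lfyy2 : ℝ≥0)
    (hLFy1 : ∀ y, LipschitzWith LFy1 fun x => grady F x y)
    (hLFy2 : ∀ x, LipschitzWith LFy2 fun y => grady F x y)
    (hLfy1 : ∀ y, LipschitzWith Lfy1 fun x => grady f x y)
    (hLfy2 : ∀ x, LipschitzWith Lfy2 fun y => grady f x y)
    (hLFyy1 : ∀ y, LipschitzWith LFyy1 fun x => hessyy F x y)
    (hLFyy2 : ∀ x, LipschitzWith LFyy2 fun y => hessyy F x y)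
    (hLfyy1 : ∀ y, LipschitzWith Lfyy1 fun x => hessyy f x y)
    (hLfyy2 : ∀ x, LipschitzWith Lfyy2 fun y => hessyy f x y)
    (σF σf : ℝ) (hσF : 0 < σF) (hσf : 0 ≤ σf)
    (hFsc : ∀ x, StrongConvexOn univ σF (F x))
    (hfsc : ∀ x, StrongConvexOn univ σf (f x))
    (μ : ℝ) (hμ : μ ∈ Icc (0 : ℝ) 1)
    (σψ : ℝ) (hσψ : σψ = μ * σF + (1 - μ) * σf) (hσψpos : 0 < σψ)
    (ystar : Eu n → Eu m)
    (hmin : ∀ x y, aggreg μ F f x (ystar x) ≤ aggreg μ F f x y)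
    (vstar : Eu n → Eu m)
    (hvstar : ∀ x, vstar x =
      (hessyy (aggreg μ F f) x (ystar x)).inverse (grady F x (ystar x)))
    (Lψy1 Lψyy1 Lψyy2 Lv1 Lv2 : ℝ)
    (hLψy1 : Lψy1 = μ * LFy1 + (1 - μ) * Lfy1)
    (hLψyy1 : Lψyy1 = μ * LFyy1 + (1 - μ) * Lfyy1)
    (hLψyy2 : Lψyy2 = μ * LFyy2 + (1 - μ) * Lfyy2)
    (hLv1 : Lv1 = Lψyy2 * Lψy1 + Lψyy1 * σψ)
    (hLv2 : Lv2 = LFy2 * Lψy1 + LFy1 * σψ) :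
    ∀ x x', ‖vstar x - vstar x'‖ ≤
      ((Lv1 * ‖vstar x‖ + Lv2) / σψ ^ 2) * ‖x - x'‖ := by
  intro x x'
  have hdF := differentiable_right_of_contDiff_uncurry hF
  have hdf := differentiable_right_of_contDiff_uncurry hf
  have hmono : ∀ x a b, σψ * ‖b - a‖ ^ 2 ≤
      ⟪grady (aggreg μ F f) x b - grady (aggreg μ F f) x a, b - a⟫ := fun x a b =>
    hσψ ▸ le_inner_grady_aggreg_sub hμ (hdF x) (hdf x) (hFsc x) (hfsc x) a b
  have hcrit : ∀ x, grady (aggreg μ F f) x (ystar x) = 0 := fun x => by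
    have : IsLocalMin (fun y => aggreg μ F f x y) (ystar x) := Eventually.of_forall (hmin x)
    simp only [grady, gradient, this.fderiv_eq_zero, map_zero]
  have hy : σψ * ‖ystar x - ystar x'‖ ≤ Lψy1 * ‖x - x'‖ := by
    refine (mul_norm_le_of_mul_norm_sq_le_inner (hmono x' (ystar x') (ystar x))).trans ?_
    rw [hcrit x', ← hcrit x, norm_sub_rev, grady_aggreg μ (hdF x) (hdf x),
      grady_aggreg μ (hdF x') (hdf x'), hLψy1]
    exact norm_convexComb_sub_le hμ ((hLFy1 _).norm_sub_le x x') ((hLfy1 _).norm_sub_le x x')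
  have hbelow : ∀ x v, σψ * ‖v‖ ≤ ‖hessyy (aggreg μ F f) x (ystar x) v‖ := fun x v => by
    rw [hessyy_aggreg μ hF hf]
    exact mul_norm_le_of_mul_norm_sq_le_inner
      ((hasFDerivAt_grady_aggreg μ hF hf x (ystar x)).le_inner_of_stronglyMonotone (hmono x) v)
  have hsolve : ∀ x, hessyy (aggreg μ F f) x (ystar x) (vstar x) = grady F x (ystar x) := fun x =>
    (((ContinuousLinearMap.isInvertible_of_mul_norm_le hσψpos (hbelow x)).inverse_apply_eq).1
      (hvstar x).symm).symm
  have hH : ‖hessyy (aggreg μ F f) x (ystar x) - hessyy (aggreg μ F f) x' (ystar x')‖ ≤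
      Lψyy1 * ‖x - x'‖ + Lψyy2 * ‖ystar x - ystar x'‖ := by
    have h := norm_convexComb_sub_le (d := 1) hμ
      ((norm_sub_le_of_lipschitzWith hLFyy1 hLFyy2 x x' (ystar x) (ystar x')).trans_eq
        (mul_one _).symm)
      ((norm_sub_le_of_lipschitzWith hLfyy1 hLfyy2 x x' (ystar x) (ystar x')).trans_eq
        (mul_one _).symm)
    rw [hessyy_aggreg μ hF hf, hessyy_aggreg μ hF hf, hLψyy1, hLψyy2]
    exact h.trans_eq (by ring)
  have hg := norm_sub_le_of_lipschitzWith hLFy1 hLFy2 x x' (ystar x) (ystar x')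
  have hv := ContinuousLinearMap.mul_norm_sub_le_of_mul_norm_le
    (A := hessyy (aggreg μ F f) x (ystar x)) (hbelow x') (vstar x) (vstar x')
  rw [hsolve, hsolve] at hv
  have hLψyy2_nonneg : 0 ≤ Lψyy2 := by
    rw [hLψyy2]
    exact add_nonneg (mul_nonneg hμ.1 LFyy2.2) (mul_nonneg (sub_nonneg.2 hμ.2) Lfyy2.2)
  have hbound : σψ * ‖vstar x - vstar x'‖ ≤
      (Lψyy1 * ‖vstar x‖ + LFy1) * ‖x - x'‖ +
        (Lψyy2 * ‖vstar x‖ + LFy2) * ‖ystar x - ystar x'‖ := by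
    have := mul_le_mul_of_nonneg_right hH (norm_nonneg (vstar x))
    linarith
  have hcoef : 0 ≤ Lψyy2 * ‖vstar x‖ + LFy2 := by positivity
  rw [div_mul_eq_mul_div, le_div_iff₀ (by positivity), hLv1, hLv2]
  have h1 := mul_le_mul_of_nonneg_left hbound hσψpos.le
  have h2 := mul_le_mul_of_nonneg_left hy hcoef
  linarith
end
end

section
/- Under the smoothness and convexity assumptions (with f(x,·) merely convex and F(x,·) σ_F-strongly convex), for all μ, μ' with 0 < μ ≤ 1/2 and 0 < μ' ≤ 2μ, and every x ∈ ℝⁿ: ‖y*_μ(x) − y*_{μ'}(x)‖ ≤ (2‖∇_y F(x, y*_μ(x))‖ / σ_F) · |μ − μ'| / μ'. -/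
open Set Filter Asymptotics
open scoped NNReal

noncomputable section

variable {n m : ℕ}

/-- First-order lower bound for a convex function at a point of differentiability. -/
theorem ConvexOn.add_hasFDerivAt_le {E : Type*} [NormedAddCommGroup E] [NormedSpace ℝ E]
    {g : E → ℝ} {g' : E →L[ℝ] ℝ} {y : E} (hg : ConvexOn ℝ univ g) (hd : HasFDerivAt g g' y)
    (z : E) : g y + g' (z - y) ≤ g z := by
  have hc : ConvexOn ℝ univ (g ∘ AffineMap.lineMap (k := ℝ) y z) := by
    simpa using hg.comp_affineMap (AffineMap.lineMap (k := ℝ) y z)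
  have hd0 : HasDerivAt (g ∘ AffineMap.lineMap (k := ℝ) y z) (g' (z - y)) 0 :=
    HasFDerivAt.comp_hasDerivAt (0 : ℝ) (by simpa using hd) AffineMap.hasDerivAt_lineMap
  have h := hc.le_slope_of_hasDerivAt (mem_univ 0) (mem_univ 1) one_pos hd0
  simp only [slope_def_field, Function.comp_apply, AffineMap.lineMap_apply_one,
    AffineMap.lineMap_apply_zero, sub_zero, div_one] at h
  linarith

/-- First-order lower bound for a strongly convex function at a point of differentiability. -/
theorem StrongConvexOn.add_hasFDerivAt_le {E : Type*} [NormedAddCommGroup E]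
    [InnerProductSpace ℝ E] {g : E → ℝ} {g' : E →L[ℝ] ℝ} {y : E} {c : ℝ}
    (hg : StrongConvexOn univ c g) (hd : HasFDerivAt g g' y) (z : E) :
    g y + g' (z - y) + c / 2 * ‖z - y‖ ^ 2 ≤ g z := by
  have hq : HasFDerivAt (fun w : E => g w - c / 2 * ‖w‖ ^ 2)
      (g' - (c / 2) • (2 • innerSL ℝ y)) y :=
    hd.sub ((hasStrictFDerivAt_norm_sq y).hasFDerivAt.const_mul (c / 2))
  have h := (strongConvexOn_iff_convex.mp hg).add_hasFDerivAt_le hq z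
  simp [inner_sub_right] at h
  rw [norm_sub_sq_real, real_inner_comm, map_sub]
  linarith

/-- Lemma A.3 (i): smoothness of `μ ↦ y*_μ(x)`. -/
theorem ystar_mu_smoothness {n m : ℕ}
    (F f : Eu n → Eu m → ℝ)
    (hF : ContDiff ℝ 2 (Function.uncurry F))
    (hf : ContDiff ℝ 2 (Function.uncurry f))
    (σF : ℝ) (hσF : 0 < σF)
    (hFsc : ∀ x, StrongConvexOn univ σF (F x))
    (hfconv : ∀ x, ConvexOn ℝ univ (f x))
    (ystar : ℝ → Eu n → Eu m)
    (hmin : ∀ μ ∈ Ioc (0 : ℝ) 1, ∀ x y,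
      aggreg μ F f x (ystar μ x) ≤ aggreg μ F f x y) :
    ∀ (μ μ' : ℝ), 0 < μ → μ ≤ 1 / 2 → 0 < μ' → μ' ≤ 2 * μ → ∀ x,
      ‖ystar μ x - ystar μ' x‖ ≤
        (2 * ‖grady F x (ystar μ x)‖ / σF) * (|μ - μ'| / μ') := by
  intro μ μ' hμ hμ2 hμ' hμμ' x
  have hFd : Differentiable ℝ (F x) :=
    (hF.differentiable two_ne_zero).comp (differentiable_const x |>.prodMk differentiable_id)
  have hfd : Differentiable ℝ (f x) :=
    (hf.differentiable two_ne_zero).comp (differentiable_const x |>.prodMk differentiable_id)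
  have stationary : ∀ ν ∈ Ioc (0 : ℝ) 1,
      ν • fderiv ℝ (F x) (ystar ν x) + (1 - ν) • fderiv ℝ (f x) (ystar ν x) = 0 := fun ν hν =>
    IsLocalMin.hasFDerivAt_eq_zero (f := aggreg ν F f x)
      (Eventually.of_forall (hmin ν hν x))
      (((hFd _).hasFDerivAt.const_mul ν).add ((hfd _).hasFDerivAt.const_mul (1 - ν)))
  have hs := stationary μ ⟨hμ, by linarith⟩
  have hs' := stationary μ' ⟨hμ', by linarith⟩
  set y := ystar μ x
  set z := ystar μ' x
  have e1 := congrArg (fun L : Eu m →L[ℝ] ℝ => L (z - y)) hs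
  have e2 := congrArg (fun L : Eu m →L[ℝ] ℝ => L (y - z)) hs'
  have hFy := (hFsc x).add_hasFDerivAt_le (hFd y).hasFDerivAt z
  have hfy := (hfconv x).add_hasFDerivAt_le (hfd y).hasFDerivAt z
  have hFz := (hFsc x).add_hasFDerivAt_le (hFd z).hasFDerivAt y
  have hfz := (hfconv x).add_hasFDerivAt_le (hfd z).hasFDerivAt y
  have hgrad : ‖fderiv ℝ (F x) y‖ = ‖grady F x y‖ := by
    simp [grady, gradient]
  have hb : |fderiv ℝ (F x) y (z - y)| ≤ ‖grady F x y‖ * ‖y - z‖ := by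
    rw [← hgrad, norm_sub_rev y z]
    exact (fderiv ℝ (F x) y).le_opNorm (z - y)
  simp only [add_apply, smul_apply, zero_apply, smul_eq_mul] at e1 e2
  rw [norm_sub_rev z y] at hFy
  set a := fderiv ℝ (F x) y (z - y)
  set b := fderiv ℝ (f x) y (z - y)
  set d := ‖y - z‖
  have hd0 : 0 ≤ d := norm_nonneg _
  have hμ'1 : 0 ≤ 1 - μ' := by linarith
  have monotone_bound : μ' * a + (1 - μ') * b + μ' * σF * d ^ 2 ≤ 0 := by
    linarith [mul_le_mul_of_nonneg_left hFy hμ'.le, mul_le_mul_of_nonneg_left hFz hμ'.le,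
      mul_le_mul_of_nonneg_left hfy hμ'1, mul_le_mul_of_nonneg_left hfz hμ'1]
  have scaled_bound : (1 - μ) * (μ' * σF * d ^ 2) ≤ (μ - μ') * a := by
    linear_combination mul_le_mul_of_nonneg_left monotone_bound (by linarith : 0 ≤ 1 - μ)
      - (1 - μ') * e1
  have cauchy_schwarz : (μ - μ') * a ≤ |μ - μ'| * (‖grady F x y‖ * d) :=
    (le_abs_self _).trans (by rw [abs_mul]; gcongr)
  have half_bound : 1 / 2 * (μ' * σF * d ^ 2) ≤ (1 - μ) * (μ' * σF * d ^ 2) := by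
    gcongr; linarith
  have hmul : d * (μ' * σF * d) ≤ d * (2 * ‖grady F x y‖ * |μ - μ'|) := by linarith
  rw [div_mul_div_comm, le_div_iff₀ (by positivity)]
  rcases hd0.eq_or_lt with h0 | hpos
  · rw [← h0, zero_mul]; positivity
  · linarith [le_of_mul_le_mul_left hmul hpos]
end
end
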